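/- arXiv:1002.0730 — 2 statements merged into one kernel-verified Lean document; each statement's English description precedes it below -/
import Mathlib

section
/- The convex conjugate of the function φ defined by φ(x) := (x − 1)²/(2x) for x > 0 and φ(x) := +∞ for x ≤ 0 (the function associated with the modified χ² divergence) is given by ψ(t) = 1 − √(1 − 2t) for t ≤ 1/2 and ψ(t) = +∞ for t > 1/2. -/
open MeasureTheory ProbabilityTheory Filter Set Topology
open scoped ENNReal NNReal

noncomputable section

/-- Fenchel-Legendre convex conjugate `ψ(t) = sup_{x ∈ ℝ} {t·x − φ(x)}` of an
`[0,∞]`-valued function `φ` on `ℝ`. -/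
def psi (φ : ℝ → ℝ≥0∞) (t : ℝ) : EReal :=
  ⨆ x : ℝ, ((t * x : ℝ) : EReal) - ((φ x : ℝ≥0∞) : EReal)

/-- The convex function associated with the modified `χ²` divergence:
`φ(x) = (x−1)²/(2x)` for `x > 0`, `φ(x) = +∞` for `x ≤ 0`. -/
def phiChi2m : ℝ → ℝ≥0∞ := fun x =>
  if 0 < x then ENNReal.ofReal ((x - 1) ^ 2 / (2 * x)) else ⊤

theorem phiChi2m_integrand_of_pos (t : ℝ) {x : ℝ} (hx : 0 < x) :
    ((t * x : ℝ) : EReal) - ((phiChi2m x : ℝ≥0∞) : EReal) =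
      ((1 - ((1 - 2 * t) * x + 1 / x) / 2 : ℝ) : EReal) := by
  have h : 0 ≤ (x - 1) ^ 2 / (2 * x) := by positivity
  rw [phiChi2m, if_pos hx, EReal.coe_ennreal_ofReal, max_eq_left h, ← EReal.coe_sub]
  congr 1
  field_simp
  ring

theorem phiChi2m_integrand_of_nonpos (t : ℝ) {x : ℝ} (hx : x ≤ 0) :
    ((t * x : ℝ) : EReal) - ((phiChi2m x : ℝ≥0∞) : EReal) = ⊥ := by
  rw [phiChi2m, if_neg hx.not_gt, EReal.coe_ennreal_top, EReal.sub_top]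

theorem le_psi_phiChi2m (t : ℝ) {x : ℝ} (hx : 0 < x) :
    ((1 - ((1 - 2 * t) * x + 1 / x) / 2 : ℝ) : EReal) ≤ psi phiChi2m t := by
  rw [← phiChi2m_integrand_of_pos t hx]
  exact le_iSup (fun x : ℝ => ((t * x : ℝ) : EReal) - ((phiChi2m x : ℝ≥0∞) : EReal)) x

theorem psi_phiChi2m_le {t : ℝ} (ht : t ≤ 1 / 2) :
    psi phiChi2m t ≤ ((1 - Real.sqrt (1 - 2 * t) : ℝ) : EReal) := by
  refine iSup_le fun x => ?_
  rcases le_or_gt x 0 with hx | hx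
  · rw [phiChi2m_integrand_of_nonpos t hx]
    exact bot_le
  · rw [phiChi2m_integrand_of_pos t hx, EReal.coe_le_coe_iff]
    have hs := Real.sq_sqrt (show 0 ≤ 1 - 2 * t by linarith)
    set s := Real.sqrt (1 - 2 * t)
    have h : s ^ 2 * x + 1 / x - 2 * s = (s * x - 1) ^ 2 / x := by
      field_simp
      ring
    have h' : 0 ≤ (s * x - 1) ^ 2 / x := by positivity
    rw [← hs]
    linarith

theorem le_psi_phiChi2m_of_le_half {t : ℝ} (ht : t ≤ 1 / 2) :
    ((1 - Real.sqrt (1 - 2 * t) : ℝ) : EReal) ≤ psi phiChi2m t := by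
  rcases ht.lt_or_eq with ht | rfl
  · have hpos : 0 < 1 - 2 * t := by linarith
    have hs := Real.sq_sqrt hpos.le
    have hs0 := Real.sqrt_pos.2 hpos
    set s := Real.sqrt (1 - 2 * t)
    convert le_psi_phiChi2m t (inv_pos.2 hs0) using 2
    rw [← hs]
    field_simp
    ring
  · have h : Tendsto (fun x : ℝ => 1 - ((1 - 2 * (1 / 2)) * x + 1 / x) / 2) atTop
        (𝓝 (1 - Real.sqrt (1 - 2 * (1 / 2)))) := by
      have h' := (tendsto_inv_atTop_zero (𝕜 := ℝ)).div_const 2 |>.const_sub 1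
      simpa using h'
    refine le_of_tendsto ((continuous_coe_real_ereal.tendsto _).comp h) ?_
    filter_upwards [eventually_gt_atTop 0] with x hx
    exact le_psi_phiChi2m _ hx

theorem psi_phiChi2m_eq_top {t : ℝ} (ht : 1 / 2 < t) : psi phiChi2m t = ⊤ := by
  refine EReal.eq_top_iff_forall_lt _ |>.2 fun y => ?_
  have hd : 0 < t - 1 / 2 := by linarith
  have hq : 0 ≤ |y| / (t - 1 / 2) := by positivity
  have hx : 1 ≤ |y| / (t - 1 / 2) + 1 := by linarith
  refine lt_of_lt_of_le (EReal.coe_lt_coe_iff.2 ?_) (le_psi_phiChi2m t (zero_lt_one.trans_le hx))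
  have hinv : 1 / (|y| / (t - 1 / 2) + 1) ≤ 1 := (div_le_one (by linarith)).2 hx
  have hmul : (t - 1 / 2) * (|y| / (t - 1 / 2) + 1) = |y| + (t - 1 / 2) := by
    rw [mul_add, mul_one, mul_div_cancel₀ _ hd.ne']
  have := le_abs_self y
  linarith

/-- The convex conjugate of the modified `χ²` function is
`ψ(t) = 1 − √(1 − 2t)` for `t ≤ 1/2` and `ψ(t) = +∞` for `t > 1/2`. -/
theorem conjugate_of_modified_chiSq (t : ℝ) :
    (t ≤ 1 / 2 → psi phiChi2m t = ((1 - Real.sqrt (1 - 2 * t) : ℝ) : EReal)) ∧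
    (1 / 2 < t → psi phiChi2m t = ⊤) := by
  exact ⟨fun ht => le_antisymm (psi_phiChi2m_le ht) (le_psi_phiChi2m_of_le_half ht),
    psi_phiChi2m_eq_top⟩
end
end

section
/- (Proposition 1, direct part.) Fix θ ∈ Θ and points x_1,…,x_n ∈ ℝ^m, and let P_n := (1/n) Σ_{i=1}^n δ_{x_i}. Let 𝓜_θ^{(n)} be the set of signed finite measures Q supported on {x_1,…,x_n} with Σ_{i=1}^n Q({x_i}) = 1 and Σ_{i=1}^n Q({x_i}) g(x_i,θ) = 0. If there exists Q_0 ∈ 𝓜_θ^{(n)} whose density with respect to P_n satisfies a < n·Q_0({x_i}) < b for all i = 1,…,n, then inf_{Q∈𝓜_θ^{(n)}} (1/n) Σ_{i=1}^n φ(n Q({x_i})) = sup_{t∈ℝ^{1+l}} { t_0 − (1/n) Σ_{i=1}^n ψ(tᵀḡ(x_i,θ)) }, and the supremum on the right-hand side is attained. -/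
open MeasureTheory ProbabilityTheory Filter Set Topology
open scoped ENNReal NNReal

noncomputable section

/-- `tᵀ ḡ(x,θ) = t₀ + ∑ⱼ tⱼ gⱼ(x,θ)`, where `ḡ := (𝟙, g₁, …, g_l)ᵀ`. -/
def tbar {l : ℕ} (t : Fin (l + 1) → ℝ) (gx : Fin l → ℝ) : ℝ :=
  t 0 + ∑ j : Fin l, t j.succ * gx j

/-- Standing assumptions on the divergence function `φ : ℝ → [0,∞]`: `φ(1) = 0`, `φ` is
convex and closed (lower semicontinuous), its effective domain is an interval with
endpoints `a < 1 < b`, `φ` is strictly convex and twice continuously differentiable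
(with derivatives `φ'`, `φ''`) on `]a,b[`, and essentially smooth; `a* = lim_{x→−∞} φ(x)/x`
and `b* = lim_{x→+∞} φ(x)/x` are the endpoints of the domain of the conjugate `ψ`. -/
structure PhiAssumptions (φ : ℝ → ℝ≥0∞) (a b : EReal) (φ' φ'' : ℝ → ℝ)
    (astar bstar : EReal) : Prop where
  one : φ 1 = 0
  a_lt_one : a < ((1 : ℝ) : EReal)
  one_lt_b : ((1 : ℝ) : EReal) < b
  dom_finite : ∀ x : ℝ, a < (x : EReal) → (x : EReal) < b → φ x ≠ ⊤
  dom_infinite : ∀ x : ℝ, ((x : EReal) < a ∨ b < (x : EReal)) → φ x = ⊤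
  closed : LowerSemicontinuous fun x : ℝ => ((φ x : ℝ≥0∞) : EReal)
  convex : ∀ x y p q : ℝ, 0 ≤ p → 0 ≤ q → p + q = 1 →
    φ (p * x + q * y) ≤ ENNReal.ofReal p * φ x + ENNReal.ofReal q * φ y
  strictConvexOn : StrictConvexOn ℝ {x : ℝ | a < (x : EReal) ∧ (x : EReal) < b}
    fun x => (φ x).toReal
  deriv1 : ∀ x : ℝ, a < (x : EReal) → (x : EReal) < b →
    HasDerivAt (fun y => (φ y).toReal) (φ' x) x
  deriv2 : ∀ x : ℝ, a < (x : EReal) → (x : EReal) < b → HasDerivAt φ' (φ'' x) x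
  deriv2_pos : ∀ x : ℝ, a < (x : EReal) → (x : EReal) < b → 0 < φ'' x
  deriv2_cont : ContinuousOn φ'' {x : ℝ | a < (x : EReal) ∧ (x : EReal) < b}
  ess_smooth_a : ∀ r : ℝ, a = (r : EReal) → Tendsto φ' (𝓝[>] r) atBot
  ess_smooth_b : ∀ r : ℝ, b = (r : EReal) → Tendsto φ' (𝓝[<] r) atTop
  astar_lim :
    Tendsto (fun x : ℝ => ((φ x : ℝ≥0∞) : EReal) * ((x⁻¹ : ℝ) : EReal)) atBot (𝓝 astar)
  bstar_lim :
    Tendsto (fun x : ℝ => ((φ x : ℝ≥0∞) : EReal) * ((x⁻¹ : ℝ) : EReal)) atTop (𝓝 bstar)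

/-- The empirical measure `P_n = (1/n) ∑ᵢ δ_{xᵢ}`. -/
def PnEmp {mdim : ℕ} (n : ℕ) (x : Fin n → Fin mdim → ℝ) : Measure (Fin mdim → ℝ) :=
  (n : ℝ≥0∞)⁻¹ • ∑ i : Fin n, Measure.dirac (x i)

/-- `𝓜_θ⁽ⁿ⁾`: signed finite measures `Q` supported on `{x₁,…,x_n}` (i.e. absolutely
continuous w.r.t. `P_n`) with `∑ᵢ Q({xᵢ}) = 1` and `∑ᵢ Q({xᵢ}) g(xᵢ,θ) = 0`. -/
def MThetaN {mdim d l : ℕ} (n : ℕ) (x : Fin n → Fin mdim → ℝ)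
    (g : (Fin mdim → ℝ) → (Fin d → ℝ) → Fin l → ℝ) (θ : Fin d → ℝ) :
    Set (SignedMeasure (Fin mdim → ℝ)) :=
  {Q | Q ≪ᵥ (PnEmp n x).toENNRealVectorMeasure ∧ (∑ i : Fin n, Q {x i}) = 1 ∧
    ∀ j : Fin l, (∑ i : Fin n, Q {x i} * g (x i) θ j) = 0}

/-- The primal criterion `Q ↦ (1/n) ∑ᵢ φ(n Q({xᵢ})) = ∫ φ(dQ/dP_n) dP_n`. -/
def primalObjN (φ : ℝ → ℝ≥0∞) {mdim : ℕ} (n : ℕ) (x : Fin n → Fin mdim → ℝ)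
    (Q : SignedMeasure (Fin mdim → ℝ)) : ℝ≥0∞ :=
  (n : ℝ≥0∞)⁻¹ * ∑ i : Fin n, φ ((n : ℝ) * Q {x i})

/-- The dual criterion `t ↦ t₀ − (1/n) ∑ᵢ ψ(tᵀḡ(xᵢ,θ))`, with values in `[−∞,+∞]`. -/
def dualValN (φ : ℝ → ℝ≥0∞) {mdim d l : ℕ} (n : ℕ) (x : Fin n → Fin mdim → ℝ)
    (g : (Fin mdim → ℝ) → (Fin d → ℝ) → Fin l → ℝ) (θ : Fin d → ℝ)
    (t : Fin (l + 1) → ℝ) : EReal :=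
  ((t 0 : ℝ) : EReal) -
    (((n : ℝ)⁻¹ : ℝ) : EReal) * ∑ i : Fin n, psi φ (tbar t (g (x i) θ))

theorem exists_lagrange_functional {E κ : Type*} [Finite κ] [AddCommGroup E] [Module ℝ E]
    [TopologicalSpace E] [IsTopologicalAddGroup E] [ContinuousSMul ℝ E]
    {C : Set E} {F : E → ℝ} (hC : IsOpen C) (hF : ConvexOn ℝ C F) (hFc : ContinuousOn F C)
    (L : κ → E →ₗ[ℝ] ℝ) {y₀ : E} (hy₀ : y₀ ∈ C) {p : ℝ}
    (hp : ∀ y ∈ C, (∀ k, L k y = L k y₀) → p ≤ F y) :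
    ∃ Λ ∈ Submodule.span ℝ (range L), ∀ y ∈ C, Λ y - F y ≤ Λ y₀ - p := by
  have hopen : IsOpen {z : E × ℝ | z.1 ∈ C ∧ F z.1 < z.2} := by
    have h : ContinuousOn (fun z : E × ℝ => z.2 - F z.1) (Prod.fst ⁻¹' C) :=
      continuousOn_snd.sub (hFc.comp continuousOn_fst fun _ hz => hz)
    convert h.isOpen_inter_preimage (hC.preimage continuous_fst) isOpen_Ioi (t := Ioi 0) using 1
    ext z
    simp
  have hconv : Convex ℝ {z : E × ℝ | z.2 = p ∧ ∀ k, L k z.1 = L k y₀} := by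
    rintro z ⟨hz, hzL⟩ w ⟨hw, hwL⟩ s t - - hst
    refine ⟨?_, fun k => ?_⟩
    · simp [hz, hw, ← add_mul, hst]
    · simp [hzL, hwL, ← add_mul, hst]
  obtain ⟨f, u, hfu, huf⟩ := geometric_hahn_banach_open hF.convex_strict_epigraph hopen hconv
    (Set.disjoint_left.2 fun z hz hz' => (hp z.1 hz.1 hz'.2).not_gt (hz'.1 ▸ hz.2))
  set c : ℝ := f (0, 1) with hc
  have hf (y : E) (r : ℝ) : f (y, r) = f (y, 0) + r * c := by
    rw [hc, ← smul_eq_mul, ← map_smul, ← map_add]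
    simp
  have hle (y : E) (hy : ∀ k, L k y = L k y₀) : u ≤ f (y, 0) + p * c := by
    rw [← hf]
    exact huf _ ⟨rfl, hy⟩
  have hlt (y : E) (hy : y ∈ C) (r : ℝ) (hr : F y < r) : f (y, 0) + r * c < u := by
    rw [← hf]
    exact hfu _ ⟨hy, hr⟩
  have hc0 : c < 0 := by
    have h1 := hlt y₀ hy₀ (F y₀ + 1) (by linarith)
    have h2 := hle y₀ fun _ => rfl
    have h3 := hp y₀ hy₀ fun _ => rfl
    nlinarith
  set G : E →ₗ[ℝ] ℝ := f.toLinearMap ∘ₗ LinearMap.inl ℝ E ℝ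
  have hGf (y : E) : G y = f (y, 0) := rfl
  have hker : ⨅ k, LinearMap.ker (L k) ≤ LinearMap.ker G := by
    intro v hv
    have hv' (k : κ) : L k v = 0 := by simpa using (Submodule.mem_iInf _).1 hv k
    by_contra hne
    have hne' : G v ≠ 0 := hne
    have h := hle (y₀ + ((u - p * c - G y₀ - 1) / G v) • v) fun k => by simp [hv']
    rw [← hGf, map_add, map_smul, smul_eq_mul, div_mul_cancel₀ _ hne'] at h
    linarith
  refine ⟨(-c)⁻¹ • G, Submodule.smul_mem _ _ (mem_span_of_iInf_ker_le_ker hker), fun y hy => ?_⟩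
  have hbound : G y - G y₀ ≤ (p - F y) * c := by
    refine le_of_forall_pos_le_add fun ε hε => ?_
    have h1 := hlt y hy (F y + ε / (-c)) (by have := div_pos hε (neg_pos.2 hc0); linarith)
    have h2 := hle y₀ fun _ => rfl
    rw [← hGf] at h1 h2
    have h3 : ε / (-c) * c = -ε := by
      rw [div_neg, neg_mul, div_mul_cancel₀ _ hc0.ne]
    nlinarith
  have h := mul_le_mul_of_nonneg_left hbound (inv_nonneg.2 (neg_nonneg.2 hc0.le))
  have h4 : (-c)⁻¹ * ((p - F y) * c) = F y - p := by
    rw [inv_mul_eq_div, div_eq_iff (neg_ne_zero.2 hc0.ne)]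
    ring
  simp only [LinearMap.smul_apply, smul_eq_mul]
  nlinarith

theorem exists_sum_le_of_forall_sum_le {ι α : Type*} [Fintype ι] [Nonempty α] {f : ι → α → ℝ}
    {K : ℝ} (h : ∀ y : ι → α, ∑ i, f i (y i) ≤ K) :
    ∃ v : ι → ℝ, (∀ i y, f i y ≤ v i) ∧ ∑ i, v i ≤ K := by
  classical
  have hbdd (i : ι) : BddAbove (range (f i)) := by
    obtain ⟨y₀⟩ := ‹Nonempty α›
    refine ⟨K - ∑ j ∈ Finset.univ.erase i, f j y₀, ?_⟩
    rintro _ ⟨y, rfl⟩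
    have hy := h (Function.update (fun _ => y₀) i y)
    rw [← Finset.add_sum_erase _ _ (Finset.mem_univ i), Function.update_self,
      Finset.sum_congr rfl fun j hj => by
        rw [Function.update_of_ne (Finset.ne_of_mem_erase hj)]] at hy
    linarith
  refine ⟨fun i => ⨆ y, f i y, fun i y => le_ciSup (hbdd i) y, ?_⟩
  refine le_of_forall_pos_le_add fun ε hε => ?_
  set δ : ℝ := ε / (Fintype.card ι + 1) with hδ
  have hδ0 : 0 < δ := by positivity
  choose y hy using fun i => exists_lt_of_lt_ciSup (sub_lt_self (⨆ y, f i y) hδ0)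
  have hsum : ∑ i, ((⨆ y, f i y) - δ) ≤ ∑ i, f i (y i) :=
    Finset.sum_le_sum fun i _ => (hy i).le
  have hcard : Fintype.card ι * δ ≤ ε := by
    rw [hδ, mul_div_assoc', div_le_iff₀ (by positivity)]
    nlinarith
  rw [Finset.sum_sub_distrib, Finset.sum_const, Finset.card_univ, nsmul_eq_mul] at hsum
  linarith [h y]

theorem EReal.coe_finset_sum {ι : Type*} (s : Finset ι) (f : ι → ℝ) :
    ((∑ i ∈ s, f i : ℝ) : EReal) = ∑ i ∈ s, (f i : EReal) :=
  map_sum (⟨⟨Real.toEReal, EReal.coe_zero⟩, EReal.coe_add⟩ : ℝ →+ EReal) f s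

theorem coe_sub_le_psi {φ : ℝ → ℝ≥0∞} {y : ℝ} (hy : φ y ≠ ⊤) (t : ℝ) :
    ((t * y - (φ y).toReal : ℝ) : EReal) ≤ psi φ t := by
  rw [EReal.coe_sub, EReal.coe_ennreal_toReal hy]
  exact le_iSup (fun y : ℝ => ((t * y : ℝ) : EReal) - ((φ y : ℝ≥0∞) : EReal)) y

namespace PhiAssumptions

variable {φ : ℝ → ℝ≥0∞} {a b : EReal} {φ' φ'' : ℝ → ℝ} {astar bstar : EReal}

theorem segment_one_mem_dom (hφ : PhiAssumptions φ a b φ' φ'' astar bstar) {y s : ℝ}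
    (hy : φ y ≠ ⊤) (hs : 0 < s) (hs1 : s ≤ 1) :
    a < (((1 - s) * y + s * 1 : ℝ) : EReal) ∧ (((1 - s) * y + s * 1 : ℝ) : EReal) < b := by
  have hay : a ≤ y := not_lt.1 fun h => hy (hφ.dom_infinite y (.inl h))
  have hyb : (y : EReal) ≤ b := not_lt.1 fun h => hy (hφ.dom_infinite y (.inr h))
  constructor
  · rcases le_or_gt 1 y with h | h
    · exact hφ.a_lt_one.trans_le (EReal.coe_le_coe_iff.2 (by nlinarith))
    · exact hay.trans_lt (EReal.coe_lt_coe_iff.2 (by nlinarith))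
  · rcases le_or_gt y 1 with h | h
    · exact (EReal.coe_le_coe_iff.2 (by nlinarith)).trans_lt hφ.one_lt_b
    · exact (EReal.coe_lt_coe_iff.2 (by nlinarith)).trans_le hyb

theorem psi_le_of_forall_mem_dom (hφ : PhiAssumptions φ a b φ' φ'' astar bstar) {t v : ℝ}
    (h : ∀ y : ℝ, a < (y : EReal) → (y : EReal) < b → t * y - (φ y).toReal ≤ v) :
    psi φ t ≤ v := by
  refine iSup_le fun y => ?_
  by_cases hy : φ y = ⊤
  · simp [hy]
  rw [← EReal.coe_ennreal_toReal hy, ← EReal.coe_sub, EReal.coe_le_coe_iff]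
  have hlim : Tendsto (fun s : ℝ => t * ((1 - s) * y + s * 1) - (1 - s) * (φ y).toReal)
      (𝓝[>] 0) (𝓝 (t * y - (φ y).toReal)) := by
    have hcont : Continuous
        fun s : ℝ => t * ((1 - s) * y + s * 1) - (1 - s) * (φ y).toReal := by fun_prop
    simpa using (hcont.tendsto 0).mono_left nhdsWithin_le_nhds
  refine le_of_tendsto hlim ?_
  filter_upwards [Ioc_mem_nhdsGT zero_lt_one] with s hs
  obtain ⟨ha, hb⟩ := hφ.segment_one_mem_dom hy hs.1 hs.2
  have hs0 : 0 ≤ 1 - s := sub_nonneg.2 hs.2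
  have hconv : (φ ((1 - s) * y + s * 1)).toReal ≤ (1 - s) * (φ y).toReal := by
    have hle := hφ.convex y 1 (1 - s) s hs0 hs.1.le (by ring)
    rw [hφ.one, mul_zero, add_zero] at hle
    simpa [ENNReal.toReal_mul, hs0] using
      ENNReal.toReal_mono (ENNReal.mul_ne_top ENNReal.ofReal_ne_top hy) hle
  linarith [h _ ha hb]

end PhiAssumptions

theorem isOpen_setOf_coe_between (a b : EReal) :
    IsOpen {x : ℝ | a < (x : EReal) ∧ (x : EReal) < b} :=
  isOpen_Ioo.preimage (t := Ioo a b) continuous_coe_real_ereal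

theorem convexOn_univ_pi_sum {ι : Type*} [Fintype ι] {s : Set ℝ} {f : ℝ → ℝ}
    (hf : ConvexOn ℝ s f) :
    ConvexOn ℝ (Set.univ.pi fun _ : ι => s) fun y => ∑ i, f (y i) := by
  refine ⟨convex_pi fun _ _ => hf.1, fun y hy z hz p q hp hq hpq => ?_⟩
  simp only [smul_eq_mul, Finset.mul_sum, ← Finset.sum_add_distrib]
  exact Finset.sum_le_sum fun i _ => hf.2 (hy i trivial) (hz i trivial) hp hq hpq

section Empirical

variable {mdim d l n : ℕ} {φ : ℝ → ℝ≥0∞} {x : Fin n → Fin mdim → ℝ}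
  {g : (Fin mdim → ℝ) → (Fin d → ℝ) → Fin l → ℝ} {θ : Fin d → ℝ}

theorem sum_mul_tbar (t : Fin (l + 1) → ℝ) (y : Fin n → ℝ) :
    ∑ i, tbar t (g (x i) θ) * y i =
      t 0 * ∑ i, y i + ∑ j : Fin l, t j.succ * ∑ i, y i * g (x i) θ j := by
  simp only [tbar, add_mul, Finset.sum_add_distrib, Finset.mul_sum, Finset.sum_mul]
  rw [Finset.sum_comm]
  simp only [mul_assoc, mul_comm (g _ _ _)]

theorem exists_mem_MThetaN (hx : Function.Injective x) {q : Fin n → ℝ} (hq : ∑ i, q i = 1)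
    (hg : ∀ j : Fin l, ∑ i, q i * g (x i) θ j = 0) :
    ∃ Q ∈ MThetaN n x g θ, ∀ i, Q {x i} = q i := by
  have happly (s : Set (Fin mdim → ℝ)) :
      (∑ i, VectorMeasure.dirac (x i) (q i) : SignedMeasure (Fin mdim → ℝ)) s =
        ∑ i, VectorMeasure.dirac (x i) (q i) s := by
    rw [FunLike.coe_sum, Finset.sum_apply]
  have hatom (i : Fin n) :
      (∑ i, VectorMeasure.dirac (x i) (q i) : SignedMeasure (Fin mdim → ℝ)) {x i} = q i := by
    rw [happly, Finset.sum_eq_single i]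
    · simp
    · intro k _ hk
      exact VectorMeasure.dirac_apply_of_notMem (by simpa using hx.ne hk)
    · simp
  refine ⟨∑ i, VectorMeasure.dirac (x i) (q i), ⟨?_, ?_, ?_⟩, hatom⟩
  · refine VectorMeasure.AbsolutelyContinuous.mk fun s hs h => ?_
    rw [Measure.toENNRealVectorMeasure_apply_measurable hs] at h
    rw [happly]
    refine Finset.sum_eq_zero fun i _ => VectorMeasure.dirac_apply_of_notMem fun hi => ?_
    simp [PnEmp, Measure.finsetSum_apply, hs, Finset.sum_eq_zero_iff] at h
    exact h i hi
  · simpa only [hatom] using hq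
  · simpa only [hatom] using hg

theorem sum_mul_tbar_of_mem_MThetaN {Q : SignedMeasure (Fin mdim → ℝ)}
    (hQ : Q ∈ MThetaN n x g θ) (t : Fin (l + 1) → ℝ) :
    ∑ i, tbar t (g (x i) θ) * ((n : ℝ) * Q {x i}) = n * t 0 := by
  simp only [sum_mul_tbar, mul_assoc, ← Finset.mul_sum, hQ.2.1, hQ.2.2]
  simp [mul_comm]

theorem primalObjN_eq_ofReal (hn : n ≠ 0) {Q : SignedMeasure (Fin mdim → ℝ)}
    (hQ : ∀ i, φ ((n : ℝ) * Q {x i}) ≠ ⊤) :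
    primalObjN φ n x Q =
      ENNReal.ofReal ((n : ℝ)⁻¹ * ∑ i, (φ ((n : ℝ) * Q {x i})).toReal) := by
  rw [ENNReal.ofReal_mul (by positivity), ENNReal.ofReal_sum_of_nonneg (by simp), primalObjN]
  congr 1
  · rw [ENNReal.ofReal_inv_of_pos (by positivity), ENNReal.ofReal_natCast]
  · exact Finset.sum_congr rfl fun i _ => (ENNReal.ofReal_toReal (hQ i)).symm

theorem dualValN_le_primalObjN (hn : n ≠ 0) {Q : SignedMeasure (Fin mdim → ℝ)}
    (hQ : Q ∈ MThetaN n x g θ) (t : Fin (l + 1) → ℝ) :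
    dualValN φ n x g θ t ≤ ((primalObjN φ n x Q : ℝ≥0∞) : EReal) := by
  have hn' : (n : ℝ) ≠ 0 := Nat.cast_ne_zero.2 hn
  by_cases hfin : ∀ i, φ ((n : ℝ) * Q {x i}) ≠ ⊤
  · have hsum : ((n * t 0 - ∑ i, (φ ((n : ℝ) * Q {x i})).toReal : ℝ) : EReal) ≤
        ∑ i, psi φ (tbar t (g (x i) θ)) := by
      rw [← sum_mul_tbar_of_mem_MThetaN hQ t, ← Finset.sum_sub_distrib, EReal.coe_finset_sum]
      exact Finset.sum_le_sum fun i _ => coe_sub_le_psi (hfin i) _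
    have hmul := mul_le_mul_of_nonneg_left hsum
      (EReal.coe_nonneg.2 (inv_nonneg.2 (Nat.cast_nonneg (α := ℝ) n)))
    refine (EReal.sub_le_sub le_rfl hmul).trans ?_
    rw [primalObjN_eq_ofReal hn hfin, EReal.coe_ennreal_ofReal, max_eq_left (by positivity),
      ← EReal.coe_mul, ← EReal.coe_sub, EReal.coe_le_coe_iff, mul_sub,
      inv_mul_cancel_left₀ hn']
    linarith
  · push Not at hfin
    obtain ⟨i, hi⟩ := hfin
    have htop : primalObjN φ n x Q = ⊤ := by
      rw [primalObjN, ENNReal.sum_eq_top.2 ⟨i, Finset.mem_univ i, hi⟩]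
      exact ENNReal.mul_top (by simp)
    simp [htop]

theorem coe_le_dualValN {t : Fin (l + 1) → ℝ} {v : Fin n → ℝ}
    (hv : ∀ i, psi φ (tbar t (g (x i) θ)) ≤ v i) :
    ((t 0 - (n : ℝ)⁻¹ * ∑ i, v i : ℝ) : EReal) ≤ dualValN φ n x g θ t := by
  rw [EReal.coe_sub, EReal.coe_mul, EReal.coe_finset_sum]
  exact EReal.sub_le_sub le_rfl (mul_le_mul_of_nonneg_left (Finset.sum_le_sum fun i _ => hv i)
    (EReal.coe_nonneg.2 (inv_nonneg.2 (Nat.cast_nonneg n))))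

theorem exists_coe_iInf_primalObjN_le_dualValN (hn : n ≠ 0) (hx : Function.Injective x)
    {a b : EReal} {φ' φ'' : ℝ → ℝ} {astar bstar : EReal}
    (hφ : PhiAssumptions φ a b φ' φ'' astar bstar) {Q₀ : SignedMeasure (Fin mdim → ℝ)}
    (hQ₀ : Q₀ ∈ MThetaN n x g θ)
    (hab : ∀ i : Fin n, a < (((n : ℝ) * Q₀ {x i} : ℝ) : EReal) ∧
      (((n : ℝ) * Q₀ {x i} : ℝ) : EReal) < b) :
    ∃ t : Fin (l + 1) → ℝ,
      ((⨅ Q ∈ MThetaN n x g θ, primalObjN φ n x Q : ℝ≥0∞) : EReal) ≤ dualValN φ n x g θ t := by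
  have hn' : (0 : ℝ) < n := Nat.cast_pos.2 hn.bot_lt
  set I : ℝ≥0∞ := ⨅ Q ∈ MThetaN n x g θ, primalObjN φ n x Q
  set J : Set ℝ := {y : ℝ | a < (y : EReal) ∧ (y : EReal) < b}
  have hfin {y : ℝ} (hy : y ∈ J) : φ y ≠ ⊤ := hφ.dom_finite y hy.1 hy.2
  have hItop : I ≠ ⊤ := by
    refine ne_top_of_le_ne_top ?_ (iInf₂_le Q₀ hQ₀)
    rw [primalObjN_eq_ofReal hn fun i => hfin (hab i)]
    exact ENNReal.ofReal_ne_top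
  let L : Fin (l + 1) → (Fin n → ℝ) →ₗ[ℝ] ℝ := fun k =>
    ∑ i, (Fin.cons 1 (g (x i) θ) : Fin (l + 1) → ℝ) k • LinearMap.proj i
  have hL0 (y : Fin n → ℝ) : L 0 y = ∑ i, y i := by simp [L]
  have hLs (j : Fin l) (y : Fin n → ℝ) : L j.succ y = ∑ i, y i * g (x i) θ j := by
    simp [L, mul_comm]
  have hJc : ContinuousOn (fun y => (φ y).toReal) J := fun y hy =>
    (hφ.deriv1 y hy.1 hy.2).continuousAt.continuousWithinAt
  obtain ⟨Λ, hΛ, hbound⟩ := exists_lagrange_functional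
    (isOpen_set_pi Set.finite_univ fun _ _ => isOpen_setOf_coe_between a b)
    (convexOn_univ_pi_sum (ι := Fin n) hφ.strictConvexOn.convexOn)
    (continuousOn_finsetSum _ fun i _ =>
      hJc.comp (continuous_apply i).continuousOn fun y hy => hy i trivial)
    L (y₀ := fun i => n * Q₀ {x i}) (p := n * I.toReal) (fun i _ => hab i) (by
      intro y hy hLy
      have h0 : ∑ i, y i = n := by
        rw [← hL0, hLy, hL0, ← Finset.mul_sum, hQ₀.2.1, mul_one]
      have hs (j : Fin l) : ∑ i, y i * g (x i) θ j = 0 := by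
        rw [← hLs, hLy, hLs]
        simp only [mul_assoc, ← Finset.mul_sum, hQ₀.2.2, mul_zero]
      obtain ⟨Q, hQ, hQy⟩ := exists_mem_MThetaN (g := g) (θ := θ) hx (q := fun i => y i / n)
        (by rw [← Finset.sum_div, h0, div_self hn'.ne'])
        (fun j => by simp only [div_mul_eq_mul_div, ← Finset.sum_div, hs, zero_div])
      have hQy' (i : Fin n) : (n : ℝ) * Q {x i} = y i := by
        rw [hQy, mul_div_cancel₀ _ hn'.ne']
      have hle : I ≤ primalObjN φ n x Q := iInf₂_le Q hQ
      rw [primalObjN_eq_ofReal hn fun i => by rw [hQy']; exact hfin (hy i trivial)] at hle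
      have h := ENNReal.toReal_le_of_le_ofReal (by positivity) hle
      simp only [hQy'] at h
      rwa [← div_eq_inv_mul, le_div_iff₀' hn'] at h)
  obtain ⟨t, rfl⟩ := (Submodule.mem_span_range_iff_exists_fun ℝ).1 hΛ
  have hΛt (y : Fin n → ℝ) : (∑ k, t k • L k) y = ∑ i, tbar t (g (x i) θ) * y i := by
    rw [sum_mul_tbar, LinearMap.sum_apply, Fin.sum_univ_succ]
    simp [hL0, hLs]
  have : Nonempty J := ⟨⟨1, hφ.a_lt_one, hφ.one_lt_b⟩⟩
  obtain ⟨v, hv, hvsum⟩ := exists_sum_le_of_forall_sum_le (ι := Fin n) (α := J)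
    (f := fun i y => tbar t (g (x i) θ) * y - (φ y).toReal)
    (K := n * t 0 - n * I.toReal) fun y => by
      have h := hbound (fun i => y i) fun i _ => (y i).2
      rw [hΛt, hΛt, sum_mul_tbar_of_mem_MThetaN hQ₀] at h
      rwa [Finset.sum_sub_distrib]
  refine ⟨t, le_trans ?_ (coe_le_dualValN (v := v) fun i =>
    hφ.psi_le_of_forall_mem_dom fun y ha hb => hv i ⟨y, ha, hb⟩)⟩
  rw [← EReal.coe_ennreal_toReal hItop, EReal.coe_le_coe_iff, ← div_eq_inv_mul, le_sub_comm,
    div_le_iff₀' hn', mul_sub]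
  exact hvsum

end Empirical

/-- **Proposition 1, direct part.** Fix `θ ∈ Θ` and points
`x₁,…,x_n ∈ ℝ^m`.  If there exists `Q₀ ∈ 𝓜_θ⁽ⁿ⁾` with `a < n·Q₀({xᵢ}) < b` for all `i`,
then the primal infimum `inf_{Q ∈ 𝓜_θ⁽ⁿ⁾} (1/n) ∑ᵢ φ(n Q({xᵢ}))` equals the dual
supremum `sup_{t ∈ ℝ^{1+l}} {t₀ − (1/n) ∑ᵢ ψ(tᵀḡ(xᵢ,θ))}`, and the dual supremum is
attained. -/
theorem duality_empirical_direct {mdim d l n : ℕ} (hdl : d ≤ l)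
    (φ : ℝ → ℝ≥0∞) (a b : EReal) (φ' φ'' : ℝ → ℝ) (astar bstar : EReal)
    (hφ : PhiAssumptions φ a b φ' φ'' astar bstar)
    (Θset : Set (Fin d → ℝ)) (θ : Fin d → ℝ) (hθ : θ ∈ Θset)
    (g : (Fin mdim → ℝ) → (Fin d → ℝ) → Fin l → ℝ)
    (hgmeas : ∀ θ', Measurable fun x => g x θ')
    (x : Fin n → Fin mdim → ℝ) (hx : Function.Injective x)
    (hfeas : ∃ Q₀ ∈ MThetaN n x g θ, ∀ i : Fin n,
      a < (((n : ℝ) * Q₀ {x i} : ℝ) : EReal) ∧ (((n : ℝ) * Q₀ {x i} : ℝ) : EReal) < b) :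
    ((⨅ Q ∈ MThetaN n x g θ, primalObjN φ n x Q : ℝ≥0∞) : EReal)
        = (⨆ t : Fin (l + 1) → ℝ, dualValN φ n x g θ t) ∧
    ∃ t : Fin (l + 1) → ℝ,
      dualValN φ n x g θ t = ⨆ t' : Fin (l + 1) → ℝ, dualValN φ n x g θ t' := by
  obtain ⟨Q₀, hQ₀, hab⟩ := hfeas
  have hn : n ≠ 0 := by
    rintro rfl
    simpa using hQ₀.2.1
  obtain ⟨t, ht⟩ := exists_coe_iInf_primalObjN_le_dualValN hn hx hφ hQ₀ hab
  have hweak (t' : Fin (l + 1) → ℝ) : dualValN φ n x g θ t' ≤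
      ((⨅ Q ∈ MThetaN n x g θ, primalObjN φ n x Q : ℝ≥0∞) : EReal) := by
    refine ((le_max_right 0 _).trans EReal.coe_toENNReal_eq_max.ge).trans
      (EReal.coe_ennreal_le_coe_ennreal_iff.2 ?_)
    exact le_iInf₂ fun Q hQ => EReal.toENNReal_coe (x := primalObjN φ n x Q) ▸
      EReal.toENNReal_le_toENNReal (dualValN_le_primalObjN hn hQ t')
  exact ⟨le_antisymm (ht.trans (le_iSup _ t)) (iSup_le hweak), t,
    le_antisymm (le_iSup _ t) (iSup_le fun t' => (hweak t').trans ht)⟩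
end
end
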